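/- Let a ∈ ℂ with Im a > 0, and write q(z) = (z−1)(z−a)(z−ā), where ā is the complex conjugate of a. Let γ : [0,1] → ℂ be an injective continuously differentiable path with γ(0) = ā, γ(1) = a, and γ(s) ∉ [0,1] (the real segment from 0 to 1) for every s ∈ [0,1]. Let f : [0,1] → ℂ be any continuous function with f(s)² = q(γ(s))/γ(s) for all s ∈ [0,1]. Then Re ∫₀¹ f(s)·γ'(s) ds = 0. -/

import Mathlib

open Complex
open scoped Topology ComplexConjugate

/-- A holomorphic function on a convex set (not necessarily open) is the derivative of its
integral along segments issued from a fixed point of the set. -/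
theorem hasDerivWithinAt_curveIntegral_segment {F : ℂ → ℂ} {s : Set ℂ} (hs : Convex ℝ s)
    (hF : DifferentiableOn ℂ F s) {p z : ℂ} (hp : p ∈ s) (hz : z ∈ s) :
    HasDerivWithinAt
      (fun w ↦ ∫ᶜ x in .segment p w, (1 : ℂ →L[ℂ] ℂ).smulRight (F x)) (F z) s z := by
  rw [hasDerivWithinAt_iff_hasFDerivWithinAt]
  apply hs.hasFDerivWithinAt_curveIntegral_segment_of_hasFDerivWithinAt_symmetric
    (ω := fun x ↦ (1 : ℂ →L[ℂ] ℂ).smulRight (F x)) ?_ ?_ hp hz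
  rotate_left
  · intro x hx
    exact (ContinuousLinearMap.smulRightL ℂ ℂ ℂ 1).hasFDerivAt
      |>.comp_hasDerivWithinAt x (hF x hx).hasDerivWithinAt |>.restrictScalars ℝ
  · rintro a ha x - y -
    simpa using mul_left_comm ..

/-- The open upper half-plane together with an interval of the real axis is convex. -/
theorem convex_upperHalfPlane_union_interval (x r : ℝ) :
    Convex ℝ {z : ℂ | 0 ≤ z.im ∧ (z.im = 0 → |z.re - x| < r)} := by
  rw [convex_iff_forall_pos]
  rintro z ⟨hz, hz'⟩ w ⟨hw, hw'⟩ p q hp hq hpq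
  simp only [Set.mem_ofPred_eq, add_im, real_smul, im_ofReal_mul, add_re, re_ofReal_mul]
  have h1 := mul_nonneg hp.le hz
  have h2 := mul_nonneg hq.le hw
  refine ⟨by positivity, fun h ↦ ?_⟩
  have hz0 : z.im = 0 := (mul_eq_zero.1 (by linarith : p * z.im = 0)).resolve_left hp.ne'
  have hw0 : w.im = 0 := (mul_eq_zero.1 (by linarith : q * w.im = 0)).resolve_left hq.ne'
  have hz1 := abs_lt.1 (hz' hz0)
  have hw1 := abs_lt.1 (hw' hw0)
  obtain rfl : p = 1 - q := by linarith
  rw [abs_lt]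
  constructor <;> nlinarith

/-- A holomorphic function on an open set containing the open upper half-plane has a primitive
on the part of this set lying in the closed upper half-plane. -/
theorem exists_hasDerivWithinAt_closedUpperHalfPlane {F : ℂ → ℂ} {S : Set ℂ} (hS : IsOpen S)
    (hS' : ∀ z : ℂ, 0 < z.im → z ∈ S) (hF : DifferentiableOn ℂ F S) :
    ∃ G : ℂ → ℂ, ∀ z ∈ S, 0 ≤ z.im → HasDerivWithinAt G (F z) {w | 0 ≤ w.im} z := by
  refine ⟨fun w ↦ ∫ᶜ x in .segment I w, (1 : ℂ →L[ℂ] ℂ).smulRight (F x), fun z hz hzi ↦ ?_⟩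
  obtain ⟨r, hr, hrS, hr'⟩ : ∃ r : ℝ,
      (z.im = 0 → 0 < r) ∧ (∀ w : ℂ, w.im = 0 → |w.re - z.re| < r → w ∈ S) ∧
      {w : ℂ | 0 ≤ w.im ∧ (w.im = 0 → |w.re - z.re| < r)} ∈ 𝓝[{w | 0 ≤ w.im}] z := by
    rcases hzi.eq_or_lt with h | h
    · obtain ⟨r, hr, hrS⟩ := Metric.isOpen_iff.1 hS z hz
      refine ⟨r, fun _ ↦ hr, fun w hw hwz ↦ hrS ?_, ?_⟩
      · rw [Metric.mem_ball, dist_eq_norm]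
        have : w - z = ((w.re - z.re : ℝ) : ℂ) := by
          apply Complex.ext <;> simp [hw, ← h]
        rwa [this, norm_real]
      · filter_upwards [self_mem_nhdsWithin, mem_nhdsWithin_of_mem_nhds (Metric.ball_mem_nhds z hr)]
          with w hw hw'
        refine ⟨hw, fun _ ↦ ?_⟩
        rw [Metric.mem_ball, dist_eq_norm] at hw'
        exact (abs_re_le_norm (w - z)).trans_lt hw'
    · refine ⟨0, fun h' ↦ absurd h' h.ne', fun w _ hw ↦ absurd hw (abs_nonneg _).not_gt, ?_⟩
      apply mem_nhdsWithin_of_mem_nhds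
      filter_upwards [(isOpen_lt continuous_const continuous_im).mem_nhds h] with w hw
      exact ⟨le_of_lt hw, fun h' ↦ absurd h' (ne_of_gt hw)⟩
  refine HasDerivWithinAt.mono_of_mem_nhdsWithin
    (hasDerivWithinAt_curveIntegral_segment (convex_upperHalfPlane_union_interval z.re r)
      (hF.mono ?_) (p := I) (by simp) ⟨hzi, fun h ↦ by simpa using hr h⟩) hr'
  rintro w ⟨hw, hw'⟩
  rcases hw.eq_or_lt with h | h
  exacts [hrS w h.symm (hw' h.symm), hS' w h]

/-- If `F` is holomorphic on an open set containing all non-real numbers and commutes with complex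
conjugation, then the real part of `F(z) dz` is the differential of a function invariant under
complex conjugation. -/
theorem exists_conj_invariant_re_primitive {F : ℂ → ℂ} {S : Set ℂ} (hS : IsOpen S)
    (hS' : ∀ z : ℂ, z.im ≠ 0 → z ∈ S) (hF : DifferentiableOn ℂ F S)
    (hconj : ∀ z ∈ S, F (conj z) = conj (F z)) :
    ∃ H : ℂ → ℝ, (∀ z, H (conj z) = H z) ∧ ∀ z ∈ S, HasFDerivAt H
      (reCLM.comp (((1 : ℂ →L[ℂ] ℂ).smulRight (F z)).restrictScalars ℝ)) z := by
  obtain ⟨G, hG⟩ := exists_hasDerivWithinAt_closedUpperHalfPlane hS (fun z hz ↦ hS' z hz.ne') hF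
  set H : ℂ → ℝ := fun z ↦ (G (z.re + |z.im| * I)).re with hH
  have hHup : ∀ z : ℂ, 0 ≤ z.im → H z = (G z).re := fun z hz ↦ by
    simp only [hH, abs_of_nonneg hz, re_add_im]
  have hHconj : ∀ z, H (conj z) = H z := fun z ↦ by simp [hH]
  have hclosed : IsClosed {w : ℂ | 0 ≤ w.im} := isClosed_le continuous_const continuous_im
  have hclosed' : IsClosed {w : ℂ | w.im ≤ 0} := isClosed_le continuous_im continuous_const
  have hup : ∀ z ∈ S, 0 ≤ z.im → HasFDerivWithinAt H
      (reCLM.comp (((1 : ℂ →L[ℂ] ℂ).smulRight (F z)).restrictScalars ℝ)) {w | 0 ≤ w.im} z :=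
    fun z hz hzi ↦ (reCLM.hasFDerivAt.comp_hasFDerivWithinAt z
      ((hG z hz hzi).hasFDerivWithinAt.restrictScalars ℝ)).congr hHup (hHup z hzi)
  refine ⟨H, hHconj, fun z hz ↦ ?_⟩
  rw [← hasFDerivWithinAt_univ,
    ← Set.eq_univ_of_forall (s := {w : ℂ | 0 ≤ w.im} ∪ {w : ℂ | w.im ≤ 0}) 
      (fun w ↦ le_total (0 : ℝ) w.im)]
  refine HasFDerivWithinAt.union ?_ ?_
  · by_cases h : 0 ≤ z.im
    · exact hup z hz h
    · exact .of_notMem_closure (by rwa [hclosed.closure_eq])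
  · by_cases h : z.im ≤ 0
    · have hzS : conj z ∈ S := by
        by_cases h0 : z.im = 0
        · rwa [conj_eq_iff_im.2 h0]
        · exact hS' _ (by simpa using h0)
      have h1 := (hup (conj z) hzS (by simpa using h)).comp z
        (conjCLE.hasFDerivAt.hasFDerivWithinAt (s := {w : ℂ | w.im ≤ 0}))
        (fun w hw ↦ by simpa using hw)
      refine (h1.congr_fderiv ?_).congr (fun w _ ↦ (hHconj w).symm) (hHconj z).symm
      ext v
      simp [hconj z hz]
    · exact .of_notMem_closure (by rwa [hclosed'.closure_eq])

/-- A continuous square root of a differentiable function is differentiable where it does not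
vanish. -/
theorem HasDerivAt.of_sq {w : ℝ → ℂ} {s : ℝ} {d : ℂ} (hw : ContinuousAt w s) (hws : w s ≠ 0)
    (hd : HasDerivAt (fun t ↦ w t ^ 2) (2 * w s * d) s) : HasDerivAt w d s := by
  have h2 : w s + w s ≠ 0 := by simpa [← two_mul] using hws
  rw [hasDerivAt_iff_tendsto_slope] at hd ⊢
  have hsum : Filter.Tendsto (fun t ↦ w t + w s) (𝓝[≠] s) (𝓝 (w s + w s)) :=
    (hw.tendsto.mono_left nhdsWithin_le_nhds).add_const _
  have := hd.div hsum h2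
  rw [show 2 * w s * d / (w s + w s) = d by field_simp; ring] at this
  refine this.congr' ?_
  filter_upwards [hsum.eventually_ne h2] with t ht
  simp only [Pi.div_apply, slope, vsub_eq_sub, real_smul]
  field_simp
  ring

theorem one_sub_inv_mem_slitPlane {z : ℂ} (hz : z ∉ segment ℝ (0 : ℂ) 1) :
    1 - z⁻¹ ∈ slitPlane := by
  rw [mem_slitPlane_iff_not_le_zero]
  intro h
  obtain ⟨hre, him⟩ := Complex.le_def.1 h
  refine hz ?_
  have hzinv : z⁻¹ = ((z⁻¹.re : ℝ) : ℂ) := by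
    apply Complex.ext
    · simp
    · simpa using him
  have hr : 1 ≤ z⁻¹.re := by simpa using hre
  set r := z⁻¹.re
  have hzr : z = ((r⁻¹ : ℝ) : ℂ) := by rw [ofReal_inv, ← hzinv, inv_inv]
  refine ⟨1 - r⁻¹, r⁻¹, sub_nonneg.2 (inv_le_one_of_one_le₀ hr), by positivity, by ring, ?_⟩
  simp [hzr]

/-- The branch of `√((z - 1) / z)` on the complement of `[0, 1]` which tends to `1` at infinity. -/
noncomputable def sqrtOneSubInv (z : ℂ) : ℂ := (1 - z⁻¹) ^ (1 / 2 : ℂ)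

theorem sqrtOneSubInv_sq (z : ℂ) : sqrtOneSubInv z ^ 2 = 1 - z⁻¹ := by
  simp [sqrtOneSubInv]

theorem sqrtOneSubInv_conj {z : ℂ} (hz : z ∉ segment ℝ (0 : ℂ) 1) :
    sqrtOneSubInv (conj z) = conj (sqrtOneSubInv z) := by
  have h := conj_cpow (1 - z⁻¹) (1 / 2) (slitPlane_arg_ne_pi (one_sub_inv_mem_slitPlane hz))
  simpa [sqrtOneSubInv, conj_ofNat] using h

theorem ne_zero_of_notMem_segment {z : ℂ} (hz : z ∉ segment ℝ (0 : ℂ) 1) : z ≠ 0 := by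
  rintro rfl
  exact hz (left_mem_segment ..)

theorem differentiableAt_sqrtOneSubInv {z : ℂ} (hz : z ∉ segment ℝ (0 : ℂ) 1) :
    DifferentiableAt ℂ sqrtOneSubInv z :=
  ((differentiableAt_const _).sub (differentiableAt_inv (ne_zero_of_notMem_segment hz))).cpow_const
    (one_sub_inv_mem_slitPlane hz)

theorem sqrtOneSubInv_ne_zero {z : ℂ} (hz : z ∉ segment ℝ (0 : ℂ) 1) : sqrtOneSubInv z ≠ 0 := by
  intro h
  have := sqrtOneSubInv_sq z
  rw [h, zero_pow two_ne_zero] at this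
  exact slitPlane_ne_zero (one_sub_inv_mem_slitPlane hz) this.symm

/-- The rational parametrization of the `z`-coordinate of the conic `w² = (z - a) (z - ā)`. -/
noncomputable def conicZ (a u : ℂ) : ℂ := a.re + a.im / 2 * (u - u⁻¹)

/-- The rational parametrization of the `w`-coordinate of the conic `w² = (z - a) (z - ā)`. -/
noncomputable def conicW (a u : ℂ) : ℂ := a.im / 2 * (u + u⁻¹)

theorem conicZ_conj (a u : ℂ) : conicZ a (conj u) = conj (conicZ a u) := by
  simp [conicZ, conj_ofNat]

theorem conicW_conj (a u : ℂ) : conicW a (conj u) = conj (conicW a u) := by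
  simp [conicW, conj_ofNat]

theorem conicZ_im (a u : ℂ) : (conicZ a u).im = a.im / 2 * u.im * (1 + (normSq u)⁻¹) := by
  have : (a.im / 2 : ℂ) = ((a.im / 2 : ℝ) : ℂ) := by push_cast; rfl
  rw [conicZ, this, add_im, im_ofReal_mul]
  simp [inv_im]
  ring

theorem im_eq_zero_of_mem_segment {z : ℂ} (hz : z ∈ segment ℝ (0 : ℂ) 1) : z.im = 0 := by
  obtain ⟨p, q, -, -, -, rfl⟩ := hz
  simp

/-- The points of the conic `w² = (z - a) (z - ā)` lying over the complement of `[0, 1]`. -/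
def conicDomain (a : ℂ) : Set ℂ := {u | u ≠ 0 ∧ conicZ a u ∉ segment ℝ (0 : ℂ) 1}

theorem continuousOn_conicZ (a : ℂ) : ContinuousOn (conicZ a) {0}ᶜ :=
  continuousOn_const.add (continuousOn_const.mul (continuousOn_id.sub continuousOn_inv₀))

theorem isOpen_conicDomain (a : ℂ) : IsOpen (conicDomain a) := by
  have hc : IsClosed (segment ℝ (0 : ℂ) 1) := by
    rw [segment_eq_image]
    exact (isCompact_Icc.image (by fun_prop)).isClosed
  exact (continuousOn_conicZ a).isOpen_inter_preimage isOpen_compl_singleton hc.isOpen_compl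

theorem mem_conicDomain_of_im_ne_zero {a u : ℂ} (ha : 0 < a.im) (hu : u.im ≠ 0) :
    u ∈ conicDomain a := by
  refine ⟨fun h ↦ hu (by simp [h]), fun h ↦ ?_⟩
  have := im_eq_zero_of_mem_segment h
  rw [conicZ_im] at this
  have h1 : 0 < 1 + (normSq u)⁻¹ := by have := normSq_nonneg u; positivity
  simp [ha.ne', hu, h1.ne'] at this

/-- The pull-back of `√(q(z) / z) dz` to the conic `w² = (z - a) (z - ā)`. -/
noncomputable def conicForm (a u : ℂ) : ℂ := sqrtOneSubInv (conicZ a u) * conicW a u ^ 2 / u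

theorem differentiableOn_conicForm (a : ℂ) :
    DifferentiableOn ℂ (conicForm a) (conicDomain a) := by
  rintro u ⟨hu, hz⟩
  have hZ : DifferentiableAt ℂ (conicZ a) u := by unfold conicZ; fun_prop (disch := assumption)
  have hW : DifferentiableAt ℂ (conicW a) u := by unfold conicW; fun_prop (disch := assumption)
  exact ((((differentiableAt_sqrtOneSubInv hz).comp u hZ).mul (hW.pow 2)).div
    differentiableAt_id hu).differentiableWithinAt

theorem conicForm_conj {a u : ℂ} (hu : u ∈ conicDomain a) :
    conicForm a (conj u) = conj (conicForm a u) := by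
  simp [conicForm, conicZ_conj, conicW_conj, sqrtOneSubInv_conj hu.2]

theorem sub_mul_sub_conj (a z : ℂ) : (z - a) * (z - conj a) = (z - a.re) ^ 2 + a.im ^ 2 := by
  have h : a = a.re + a.im * I := (re_add_im a).symm
  have h' : conj a = a.re - a.im * I := by apply Complex.ext <;> simp
  rw [h']
  nth_rw 1 [h]
  linear_combination -(a.im : ℂ) ^ 2 * I_sq

theorem conic_inverse {a z w : ℂ} (ha : a.im ≠ 0) (h : w ^ 2 = (z - a) * (z - conj a)) :
    (z - a.re + w) / a.im ≠ 0 ∧ conicZ a ((z - a.re + w) / a.im) = z ∧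
      conicW a ((z - a.re + w) / a.im) = w := by
  have hc : (a.im : ℂ) ≠ 0 := ofReal_ne_zero.2 ha
  rw [sub_mul_sub_conj] at h
  have hmul : (z - a.re + w) * (w - (z - a.re)) = a.im ^ 2 := by linear_combination h
  have h0 : z - a.re + w ≠ 0 := fun h0 ↦ pow_ne_zero 2 hc (by rw [← hmul, h0, zero_mul])
  have hinv : ((z - a.re + w) / a.im)⁻¹ = (w - (z - a.re)) / a.im := by
    rw [inv_div, div_eq_div_iff h0 hc]
    linear_combination -hmul
  refine ⟨div_ne_zero h0 hc, ?_, ?_⟩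
  · rw [conicZ, hinv]; field_simp; ring
  · rw [conicW, hinv]; field_simp; ring

/-- For `a` in the upper half-plane and `q(z) = (z-1)(z-a)(z-ā)`, the real part of
`∫_γ √(q(t)/t) dt` vanishes along any Jordan arc `γ` joining `ā` to `a` in `ℂ \ [0,1]`,
where `f` is a continuous branch of the square root of `q/t` along `γ`. -/
theorem stmt_4 (a : ℂ) (ha : 0 < a.im)
    (γ : ℝ → ℂ)
    (hγdiff : ContDiffOn ℝ 1 γ (Set.Icc 0 1))
    (hγinj : Set.InjOn γ (Set.Icc 0 1))
    (hγ0 : γ 0 = (starRingEnd ℂ) a) (hγ1 : γ 1 = a)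
    (hγavoid : ∀ s ∈ Set.Icc (0 : ℝ) 1, γ s ∉ segment ℝ (0 : ℂ) 1)
    (f : ℝ → ℂ)
    (hfcont : ContinuousOn f (Set.Icc 0 1))
    (hfsq : ∀ s ∈ Set.Icc (0 : ℝ) 1,
      f s ^ 2 = (γ s - 1) * (γ s - a) * (γ s - (starRingEnd ℂ) a) / γ s) :
    (∫ s in (0 : ℝ)..1, f s * derivWithin γ (Set.Icc 0 1) s).re = 0 := by
  have h0mem : (0 : ℝ) ∈ Set.Icc (0 : ℝ) 1 := ⟨le_rfl, zero_le_one⟩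
  have h1mem : (1 : ℝ) ∈ Set.Icc (0 : ℝ) 1 := ⟨zero_le_one, le_rfl⟩
  have hc : (a.im : ℂ) ≠ 0 := ofReal_ne_zero.2 ha.ne'
  obtain ⟨H, hHconj, hH⟩ := exists_conj_invariant_re_primitive (isOpen_conicDomain a)
    (fun z ↦ mem_conicDomain_of_im_ne_zero ha) (differentiableOn_conicForm a)
    (fun z ↦ conicForm_conj)
  set w : ℝ → ℂ := fun s ↦ f s / sqrtOneSubInv (γ s) with hw
  have hfw : ∀ s ∈ Set.Icc (0 : ℝ) 1, f s = sqrtOneSubInv (γ s) * w s := fun s hs ↦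
    (mul_div_cancel₀ _ (sqrtOneSubInv_ne_zero (hγavoid s hs))).symm
  have hwsq : ∀ s ∈ Set.Icc (0 : ℝ) 1, w s ^ 2 = (γ s - a) * (γ s - conj a) := fun s hs ↦ by
    have h1 := hfsq s hs
    have h2 := sqrtOneSubInv_sq (γ s)
    have h3 := ne_zero_of_notMem_segment (hγavoid s hs)
    have h4 := pow_ne_zero 2 (sqrtOneSubInv_ne_zero (hγavoid s hs))
    apply mul_left_cancel₀ h4
    rw [← mul_pow, ← hfw s hs, h1, h2]
    field_simp
  have hwcont : ContinuousOn w (Set.Icc 0 1) := hfcont.div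
    (fun s hs ↦ (differentiableAt_sqrtOneSubInv (hγavoid s hs)).continuousAt.comp_continuousWithinAt
      (hγdiff.continuousOn s hs)) fun s hs ↦ sqrtOneSubInv_ne_zero (hγavoid s hs)
  set u : ℝ → ℂ := fun s ↦ (γ s - a.re + w s) / a.im with hu
  have hinv := fun s hs ↦ conic_inverse ha.ne' (hwsq s hs)
  have hudom : ∀ s ∈ Set.Icc (0 : ℝ) 1, u s ∈ conicDomain a := fun s hs ↦
    ⟨(hinv s hs).1, by rw [hu, (hinv s hs).2.1]; exact hγavoid s hs⟩
  have hucont : ContinuousOn u (Set.Icc 0 1) :=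
    ((hγdiff.continuousOn.sub continuousOn_const).add hwcont).div_const _
  have hHu : ContinuousOn (fun s ↦ H (u s)) (Set.Icc 0 1) := fun s hs ↦
    (hH _ (hudom s hs)).continuousAt.comp_continuousWithinAt (hucont s hs)
  have hderiv : ∀ s ∈ Set.Ioo (0 : ℝ) 1, HasDerivAt (fun s ↦ H (u s))
      (f s * derivWithin γ (Set.Icc 0 1) s).re s := by
    intro s hs
    have hs' := Set.Ioo_subset_Icc_self hs
    have hnhds : Set.Icc (0 : ℝ) 1 ∈ 𝓝 s := Icc_mem_nhds hs.1 hs.2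
    obtain ⟨hu0, hZ, hW⟩ := hinv s hs'
    set γ' := derivWithin γ (Set.Icc 0 1) s
    have hγ' : HasDerivAt γ γ' s :=
      ((hγdiff.differentiableOn one_ne_zero s hs').hasDerivWithinAt).hasDerivAt hnhds
    have hws : w s ≠ 0 := by
      intro h
      have h1 := hwsq s hs'
      rw [h, zero_pow two_ne_zero, eq_comm, mul_eq_zero, sub_eq_zero, sub_eq_zero] at h1
      rcases h1 with h1 | h1
      · exact hs.2.ne (hγinj hs' h1mem (h1.trans hγ1.symm))
      · exact hs.1.ne' (hγinj hs' h0mem (h1.trans hγ0.symm))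
    have hw' : HasDerivAt w ((γ s - a.re) * γ' / w s) s := by
      refine .of_sq (hwcont.continuousAt hnhds) hws ?_
      have h1 : HasDerivAt (fun t ↦ (γ t - a.re) ^ 2 + (a.im : ℂ) ^ 2)
          (2 * (γ s - a.re) * γ') s := by
        simpa using ((hγ'.sub_const (a.re : ℂ)).pow 2).add_const ((a.im : ℂ) ^ 2)
      refine (h1.congr_of_eventuallyEq ?_).congr_deriv ?_
      rotate_left
      · field_simp
      · filter_upwards [hnhds] with t ht
        rw [hwsq t ht, sub_mul_sub_conj]
    have hu' : HasDerivAt u (γ' * u s / w s) s := by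
      have h1 : HasDerivAt u _ s := ((hγ'.sub_const (a.re : ℂ)).add hw').div_const (a.im : ℂ)
      refine h1.congr_deriv ?_
      simp only [hu]
      field_simp
      ring
    refine ((hH (u s) (hudom s hs')).comp_hasDerivAt s hu').congr_deriv ?_
    have hform : conicForm a (u s) = sqrtOneSubInv (γ s) * w s ^ 2 / u s := by
      rw [conicForm, hu, hZ, hW]
    have hus : u s ≠ 0 := hu0
    simp only [ContinuousLinearMap.comp_apply, ContinuousLinearMap.coe_restrictScalars',
      ContinuousLinearMap.smulRight_apply, one_apply_eq_self, reCLM_apply, smul_eq_mul]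
    rw [hform, hfw s hs']
    congr 1
    field_simp
  have hint : IntervalIntegrable (fun s ↦ f s * derivWithin γ (Set.Icc 0 1) s)
      MeasureTheory.volume 0 1 := by
    apply ContinuousOn.intervalIntegrable
    rw [Set.uIcc_of_le zero_le_one]
    exact hfcont.mul (hγdiff.continuousOn_derivWithin (uniqueDiffOn_Icc zero_lt_one) le_rfl)
  have hw0 : w 0 = 0 := by simpa [hγ0] using hwsq 0 h0mem
  have hw1 : w 1 = 0 := by simpa [hγ1] using hwsq 1 h1mem
  have hu01 : u 1 = conj (u 0) := by simp [hu, hw0, hw1, hγ0, hγ1]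
  have hre := reCLM.intervalIntegral_comp_comm hint
  simp only [reCLM_apply] at hre
  rw [← hre, intervalIntegral.integral_eq_sub_of_hasDerivAt_of_le zero_le_one hHu hderiv
    ⟨reCLM.integrable_comp hint.1, reCLM.integrable_comp hint.2⟩, hu01, hHconj, sub_self]
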